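/- Let I be an inner function with I(0)=0 and f an outer function in H². Then the function g = f·k₋₁·(I+1), where k₋₁(z) = (1+z)^{−1}, lies in the kernel of the Toeplitz operator T_{Ī f̄ / f}; i.e. P₊( (Ī f̄ / f) · f (I+1)/(1+z) ) = 0. -/

import Mathlib

open Complex MeasureTheory Filter Set

noncomputable section

/-! ### Basic framework: Hardy spaces on the unit disk via boundary values -/

/-- The open unit disk in the complex plane. -/
def unitDisk : Set ℂ := Metric.ball 0 1

/-- The point `e^{iθ}` of the unit circle. -/
def uc (θ : ℝ) : ℂ := Complex.exp ((θ : ℂ) * Complex.I)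

/-- Lebesgue measure on the parameter interval `(0, 2π]` of the unit circle. -/
def bMeasure : Measure ℝ := volume.restrict (Set.Ioc 0 (2 * Real.pi))

/-- Radial limit of `f` at the boundary point `w` (`|w| = 1`). -/
def radLim (f : ℂ → ℂ) (w : ℂ) : ℂ :=
  limUnder (nhdsWithin (1 : ℝ) (Set.Iio 1)) fun r : ℝ => f ((r : ℂ) * w)

/-- The boundary value function of `f` on the unit circle. -/
def bdry (f : ℂ → ℂ) (θ : ℝ) : ℂ := radLim f (uc θ)

/-- Membership in the Hardy space `H²` of the unit disk. -/
def MemH2 (f : ℂ → ℂ) : Prop :=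
  DifferentiableOn ℂ f unitDisk ∧
    ∃ C : ℝ, ∀ r ∈ Set.Ico (0 : ℝ) 1,
      (∫ θ in (0:ℝ)..(2 * Real.pi), ‖f ((r : ℂ) * uc θ)‖ ^ 2) ≤ C

/-- Membership in the Hardy space `H¹` of the unit disk. -/
def MemH1 (f : ℂ → ℂ) : Prop :=
  DifferentiableOn ℂ f unitDisk ∧
    ∃ C : ℝ, ∀ r ∈ Set.Ico (0 : ℝ) 1,
      (∫ θ in (0:ℝ)..(2 * Real.pi), ‖f ((r : ℂ) * uc θ)‖) ≤ C

/-- Membership in `H^∞` (bounded holomorphic functions on the disk). -/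
def MemHinf (f : ℂ → ℂ) : Prop :=
  DifferentiableOn ℂ f unitDisk ∧ ∃ C : ℝ, ∀ z ∈ unitDisk, ‖f z‖ ≤ C

/-- The `H²` (normalized boundary `L²`) inner product `⟨f, g⟩`. -/
def bInner (f g : ℂ → ℂ) : ℂ :=
  (1 / (2 * (Real.pi : ℂ))) *
    ∫ θ in (0:ℝ)..(2 * Real.pi), bdry f θ * (starRingEnd ℂ) (bdry g θ)

/-- The squared `H²` norm, computed on the boundary. -/
def bNormSq (f : ℂ → ℂ) : ℝ :=
  (1 / (2 * Real.pi)) * ∫ θ in (0:ℝ)..(2 * Real.pi), ‖bdry f θ‖ ^ 2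

/-- `f` is an inner function. -/
def IsInner (f : ℂ → ℂ) : Prop :=
  DifferentiableOn ℂ f unitDisk ∧ (∀ z ∈ unitDisk, ‖f z‖ ≤ 1) ∧
    ∀ᵐ θ ∂bMeasure, ‖bdry f θ‖ = 1

/-- `f` is an outer function: it is, up to a unimodular constant, the Herglotz
exponential of the Poisson integral of `log |f*|`. -/
def IsOuter (f : ℂ → ℂ) : Prop :=
  DifferentiableOn ℂ f unitDisk ∧ ∃ c : ℂ, ‖c‖ = 1 ∧ ∀ z ∈ unitDisk,
    f z = c * Complex.exp ((1 / (2 * (Real.pi : ℂ))) *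
      ∫ θ in (0:ℝ)..(2 * Real.pi),
        ((uc θ + z) / (uc θ - z)) * ((Real.log ‖bdry f θ‖ : ℝ) : ℂ))

/-- `b` is a nonextreme point of the closed unit ball of `H^∞`:
`log (1 - |b|)` is integrable on the circle. -/
def Nonextreme (b : ℂ → ℂ) : Prop :=
  DifferentiableOn ℂ b unitDisk ∧ (∀ z ∈ unitDisk, ‖b z‖ ≤ 1) ∧
    Integrable (fun θ => Real.log (1 - ‖bdry b θ‖)) bMeasure

/-- `(b, a)` is a pair: `b` nonextreme, `a` outer, `|a|² + |b|² = 1` a.e. on the circle. -/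
def IsPair (b a : ℂ → ℂ) : Prop :=
  Nonextreme b ∧ IsOuter a ∧
    ∀ᵐ θ ∂bMeasure, ‖bdry a θ‖ ^ 2 + ‖bdry b θ‖ ^ 2 = 1

/-- `(b, a)` is the pair associated with the outer function `f` of unit `H²` norm:
`f = a / (1 - b)`. -/
def PairAssoc (f b a : ℂ → ℂ) : Prop :=
  IsOuter f ∧ MemH2 f ∧ bNormSq f = 1 ∧ IsPair b a ∧
    ∀ z ∈ unitDisk, f z = a z / (1 - b z)

/-- The Herglotz measure `μ_λ` of `(1 + λ̄b)/(1 − λ̄b)` is absolutely continuous: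
the Herglotz representation holds with density `|a/(1 − λ̄b)|²` and no singular part. -/
def HerglotzAC (b a : ℂ → ℂ) (lam : ℂ) : Prop :=
  ∀ z ∈ unitDisk,
    (1 + (starRingEnd ℂ) lam * b z) / (1 - (starRingEnd ℂ) lam * b z) =
      (1 / (2 * (Real.pi : ℂ))) *
        (∫ θ in (0:ℝ)..(2 * Real.pi),
          ((1 + (uc θ)⁻¹ * z) / (1 - (uc θ)⁻¹ * z)) *
            ((‖bdry (fun w => a w / (1 - (starRingEnd ℂ) lam * b w)) θ‖ ^ 2 : ℝ) : ℂ)) +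
      Complex.I *
        ((((1 + (starRingEnd ℂ) lam * b 0) / (1 - (starRingEnd ℂ) lam * b 0)).im : ℝ) : ℂ)

/-- The pair `(b, a)` is special: the Herglotz measure of `(1+b)/(1−b)` is
absolutely continuous. -/
def SpecialPair (b a : ℂ → ℂ) : Prop := IsPair b a ∧ HerglotzAC b a 1

/-- `F ∈ H¹` is rigid: the only functions of `H¹` with the same argument a.e. on the
circle are the positive scalar multiples of `F`. -/
def Rigid (F : ℂ → ℂ) : Prop :=
  MemH1 F ∧ ∀ G : ℂ → ℂ, MemH1 G →
    (∀ᵐ θ ∂bMeasure, ∃ t : ℝ, 0 < t ∧ bdry G θ = (t : ℂ) * bdry F θ) →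
    ∃ c : ℝ, 0 < c ∧ ∀ z ∈ unitDisk, G z = (c : ℂ) * F z

/-- The Riesz (analytic) projection `P₊` of a boundary function, realized through the
Szegő integral: `(P₊u)(z) = (1/2π) ∫ u(θ) (1 − z e^{-iθ})⁻¹ dθ`. -/
def szProj (u : ℝ → ℂ) : ℂ → ℂ := fun z =>
  (1 / (2 * (Real.pi : ℂ))) *
    ∫ θ in (0:ℝ)..(2 * Real.pi), u θ * (1 - z * (uc θ)⁻¹)⁻¹

/-- The Toeplitz operator with boundary symbol `φ`: `T_φ h = P₊(φ · h*)`. -/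
def toeplitz (φ : ℝ → ℂ) (h : ℂ → ℂ) : ℂ → ℂ := szProj fun θ => φ θ * bdry h θ

/-- The kernel of the Toeplitz operator `T_φ`, as a subset of `H²`. -/
def toeplitzKer (φ : ℝ → ℂ) : Set (ℂ → ℂ) :=
  {h | MemH2 h ∧ ∀ z ∈ unitDisk, toeplitz φ h z = 0}

/-- The boundary symbol `ḡ` of a function `g` on the disk. -/
def conjBdry (g : ℂ → ℂ) : ℝ → ℂ := fun θ => (starRingEnd ℂ) (bdry g θ)

/-- The boundary symbol `ḡ/g`. -/
def symbQuot (g : ℂ → ℂ) : ℝ → ℂ := fun θ => (starRingEnd ℂ) (bdry g θ) / bdry g θ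

/-- The boundary symbol `Ī f̄ / f`. -/
def symbIf (I f : ℂ → ℂ) : ℝ → ℂ :=
  fun θ => (starRingEnd ℂ) (bdry I θ) * (starRingEnd ℂ) (bdry f θ) / bdry f θ

/-- The model space `K_I = H² ⊖ I H² = ker T_Ī` of an inner function `I`. -/
def modelSpace (I : ℂ → ℂ) : Set (ℂ → ℂ) := toeplitzKer (conjBdry I)

/-- The set `f·K_I`. -/
def fModel (f I : ℂ → ℂ) : Set (ℂ → ℂ) :=
  {g | ∃ h ∈ modelSpace I, ∀ z ∈ unitDisk, g z = f z * h z}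

/-- The orthogonal complement `ker T_{Ī f̄/f} ⊖ f·K_I` of `f·K_I` in the kernel of
`T_{Ī f̄/f}`, with respect to the `H²` inner product. -/
def kerPerp (I f : ℂ → ℂ) : Set (ℂ → ℂ) :=
  {h | h ∈ toeplitzKer (symbIf I f) ∧ ∀ g ∈ fModel f I, bInner h g = 0}

/-- `M(a) = T_a H² = a·H²` (for `a ∈ H^∞`), the range of `T_a`, as a set. -/
def rangeMa (a : ℂ → ℂ) : Set (ℂ → ℂ) :=
  {g | ∃ h, MemH2 h ∧ ∀ z ∈ unitDisk, g z = a z * h z}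

/-- Membership in the de Branges–Rovnyak space `H(b)` for nonextreme `b` with
pair `(b, a)`:  `h ∈ H(b)` iff `h ∈ H²` and `T_b̄ h = T_ā h⁺` for some `h⁺ ∈ H²`
(Sarason's characterization). -/
def MemHb (b a h : ℂ → ℂ) : Prop :=
  MemH2 h ∧ ∃ h' : ℂ → ℂ, MemH2 h' ∧
    ∀ z ∈ unitDisk, toeplitz (conjBdry b) h z = toeplitz (conjBdry a) h' z

/-- The function `h⁺ ∈ H²` with `T_b̄ h = T_ā h⁺` (unique when it exists, since `a`
is outer). -/
def plusFun (b a h : ℂ → ℂ) : ℂ → ℂ :=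
  Classical.epsilon fun h' : ℂ → ℂ => MemH2 h' ∧
    ∀ z ∈ unitDisk, toeplitz (conjBdry b) h z = toeplitz (conjBdry a) h' z

/-- The inner product of `H(b)`: `⟨h, g⟩_b = ⟨h, g⟩₂ + ⟨h⁺, g⁺⟩₂`. -/
def hbInner (b a h g : ℂ → ℂ) : ℂ :=
  bInner h g + bInner (plusFun b a h) (plusFun b a g)

/-- The squared norm of `H(b)`. -/
def hbNormSq (b a h : ℂ → ℂ) : ℝ := (hbInner b a h h).re

/-- The closure of a set `S` in the norm of `H(b)`. -/
def hbClosure (b a : ℂ → ℂ) (S : Set (ℂ → ℂ)) : Set (ℂ → ℂ) :=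
  {h | MemHb b a h ∧ ∀ ε : ℝ, 0 < ε → ∃ g ∈ S,
    hbNormSq b a (fun z => h z - g z) < ε}

/-- The orthogonal complement of `S` in `H(b)`. -/
def hbPerp (b a : ℂ → ℂ) (S : Set (ℂ → ℂ)) : Set (ℂ → ℂ) :=
  {h | MemHb b a h ∧ ∀ g ∈ S, hbInner b a h g = 0}

/-- A set of functions on the disk is a `k`-dimensional linear subspace. -/
def HasDimOn (S : Set (ℂ → ℂ)) (k : ℕ) : Prop :=
  ∃ g : Fin k → (ℂ → ℂ), (∀ j, g j ∈ S) ∧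
    (∀ c : Fin k → ℂ, (∀ z ∈ unitDisk, (∑ j, c j * g j z) = 0) → c = 0) ∧
    ∀ h ∈ S, ∃ c : Fin k → ℂ, ∀ z ∈ unitDisk, h z = ∑ j, c j * g j z

/-- The Szegő kernel `k_w(z) = (1 - w̄ z)⁻¹` of `H²`. -/
def szKernel (w z : ℂ) : ℂ := (1 - (starRingEnd ℂ) w * z)⁻¹

/-- The reproducing kernel of `H(b)` at an interior point `w ∈ 𝔻`. -/
def hbKernel (b : ℂ → ℂ) (w z : ℂ) : ℂ :=
  (1 - (starRingEnd ℂ) (b w) * b z) / (1 - (starRingEnd ℂ) w * z)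

/-- The boundary kernel of `H(b)` at a boundary point `z₀`, defined through the
nontangential limit `b(z₀) = radLim b z₀`. -/
def hbBoundaryKernel (b : ℂ → ℂ) (z₀ z : ℂ) : ℂ :=
  (1 - (starRingEnd ℂ) (radLim b z₀) * b z) / (1 - (starRingEnd ℂ) z₀ * z)

/-- `u` is a nontangential approach sequence to the boundary point `z₀`. -/
def NTApproach (u : ℕ → ℂ) (z₀ : ℂ) : Prop :=
  (∀ n, u n ∈ unitDisk) ∧ Filter.Tendsto u Filter.atTop (nhds z₀) ∧
    ∃ M : ℝ, ∀ n, ‖u n - z₀‖ ≤ M * (1 - ‖u n‖)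

/-- `b` has an angular derivative in the sense of Carathéodory at `z₀ ∈ ∂𝔻`. -/
def HasADC (b : ℂ → ℂ) (z₀ : ℂ) : Prop :=
  ‖radLim b z₀‖ = 1 ∧ ∃ L : ℂ, ∀ u : ℕ → ℂ, NTApproach u z₀ →
    Filter.Tendsto (fun n => b (u n)) Filter.atTop (nhds (radLim b z₀)) ∧
    Filter.Tendsto (fun n => (b (u n) - radLim b z₀) / (u n - z₀)) Filter.atTop (nhds L)

lemma uc_ne_zero (θ : ℝ) : uc θ ≠ 0 := Complex.exp_ne_zero _

lemma norm_uc (θ : ℝ) : ‖uc θ‖ = 1 := Complex.norm_exp_ofReal_mul_I θ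

lemma continuous_uc : Continuous uc := by unfold uc; fun_prop

lemma uc_zero : uc 0 = 1 := by simp [uc]

lemma uc_add (s t : ℝ) : uc (s + t) = uc s * uc t := by
  simp [uc, add_mul, Complex.exp_add]

lemma uc_periodic : Function.Periodic uc (2 * Real.pi) := fun θ => by
  rw [uc_add]; simp [uc]

lemma conj_uc (θ : ℝ) : (starRingEnd ℂ) (uc θ) = (uc θ)⁻¹ := by
  rw [Complex.inv_def, Complex.normSq_eq_norm_sq, norm_uc]; simp

lemma hasDerivAt_uc (θ : ℝ) : HasDerivAt uc (uc θ * I) θ := by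
  have h : HasDerivAt (fun θ : ℝ => (θ : ℂ) * I) I θ := by
    simpa using (Complex.ofRealCLM.hasDerivAt (x := θ)).mul_const I
  exact h.cexp

lemma mem_unitDisk {z : ℂ} : z ∈ unitDisk ↔ ‖z‖ < 1 := by simp [unitDisk]

lemma norm_ofReal_mul_uc {r : ℝ} (hr : 0 ≤ r) (θ : ℝ) : ‖(r : ℂ) * uc θ‖ = r := by
  rw [norm_mul, norm_uc, mul_one, Complex.norm_of_nonneg hr]

lemma ofReal_mul_uc_mem {r : ℝ} (hr : r ∈ Set.Ico (0 : ℝ) 1) (θ : ℝ) :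
    (r : ℂ) * uc θ ∈ unitDisk := by
  rw [mem_unitDisk, norm_ofReal_mul_uc hr.1]; exact hr.2

lemma circleIntegral_eq_uc (F : ℂ → ℂ) (R : ℝ) :
    (∮ z in C(0, R), F z) =
      I * ∫ θ in (0:ℝ)..(2 * Real.pi), (R * uc θ) * F (R * uc θ) := by
  simp only [circleIntegral, deriv_circleMap, smul_eq_mul, circleMap, zero_add]
  rw [← intervalIntegral.integral_const_mul]
  refine intervalIntegral.integral_congr fun θ _ => ?_
  simp only [uc]; ring

lemma DifferentiableOn.diffContOnCl_ball_of_lt {F : ℂ → ℂ} (hF : DifferentiableOn ℂ F unitDisk)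
    {R : ℝ} (hR : R < 1) : DiffContOnCl ℂ F (Metric.ball 0 R) := by
  refine (hF.mono ?_).diffContOnCl
  exact Metric.closure_ball_subset_closedBall.trans (Metric.closedBall_subset_ball hR)

lemma DifferentiableOn.continuous_circle {F : ℂ → ℂ} (hF : DifferentiableOn ℂ F unitDisk)
    {r : ℝ} (hr : r ∈ Set.Ico (0 : ℝ) 1) : Continuous fun θ => F (r * uc θ) := by
  refine hF.continuousOn.comp_continuous ?_ (ofReal_mul_uc_mem hr)
  exact continuous_const.mul continuous_uc

/-- The derivative in the angle of the Poisson kernel, up to a factor. -/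
def poissonDeriv (r t : ℝ) : ℂ :=
  -2 * I * (((1 - r ^ 2) * Real.sin t / ‖1 - r * uc t‖ ^ 4 : ℝ) : ℂ)

lemma one_sub_mul_uc_ne_zero {r : ℝ} (hr : r ∈ Set.Ico (0 : ℝ) 1) (t : ℝ) :
    1 - r * uc t ≠ 0 := by
  intro h
  have h1 : (1 : ℂ) = r * uc t := sub_eq_zero.1 h
  have h2 := norm_ofReal_mul_uc hr.1 t
  rw [← h1, norm_one] at h2
  exact absurd h2.symm hr.2.ne

lemma poissonDeriv_eq {r : ℝ} (hr : r ∈ Set.Ico (0 : ℝ) 1) (t : ℝ) :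
    poissonDeriv r t = uc t / (uc t - r) ^ 2 - uc t / (1 - r * uc t) ^ 2 := by
  have h0 := uc_ne_zero t
  have h1 := one_sub_mul_uc_ne_zero hr t
  have h2 : (starRingEnd ℂ) (1 - r * uc t) = 1 - r * (uc t)⁻¹ := by simp [conj_uc]
  have h3 : 1 - r * (uc t)⁻¹ ≠ 0 := by rw [← h2]; exact (map_ne_zero _).2 h1
  have h5 : uc t - r = uc t * (1 - r * (uc t)⁻¹) := by field_simp
  have h6 : uc t - r ≠ 0 := h5 ▸ mul_ne_zero h0 h3
  have hn : ((‖1 - r * uc t‖ ^ 4 : ℝ) : ℂ) = ((1 - r * uc t) * (1 - r * (uc t)⁻¹)) ^ 2 := by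
    rw [← h2, Complex.mul_conj, Complex.normSq_eq_norm_sq]; push_cast; ring
  have hs : ((Real.sin t : ℝ) : ℂ) = ((uc t)⁻¹ - uc t) * I / 2 := by
    rw [Complex.ofReal_sin, Complex.sin, uc, ← Complex.exp_neg, neg_mul]
  rw [poissonDeriv, Complex.ofReal_div, hn, Complex.ofReal_mul, hs]
  push_cast
  generalize hu : uc t = u at *
  rw [h5]
  field_simp
  ring_nf
  simp only [I_sq]
  ring

lemma norm_sq_mul_one_sub_le {g : ℂ → ℂ} (hg : DifferentiableOn ℂ g unitDisk) {C : ℝ}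
    (hC : ∀ r ∈ Set.Ico (0 : ℝ) 1,
      (∫ θ in (0:ℝ)..(2 * Real.pi), ‖g ((r : ℂ) * uc θ)‖ ^ 2) ≤ C)
    {w : ℂ} (hw : w ∈ unitDisk) : ‖g w‖ ^ 2 * (1 - ‖w‖) ≤ C := by
  have hw' := mem_unitDisk.1 hw
  have hC0 : 0 ≤ C := by
    refine le_trans ?_ (hC 0 (by simp))
    exact intervalIntegral.integral_nonneg Real.two_pi_pos.le fun _ _ => by positivity
  have key : ∀ R ∈ Set.Ioo ‖w‖ 1, ‖g w‖ ^ 2 * (R - ‖w‖) ≤ C := by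
    intro R hR
    have hR0 : 0 < R := (norm_nonneg w).trans_lt hR.1
    have hR1 : R ∈ Set.Ico (0 : ℝ) 1 := ⟨hR0.le, hR.2⟩
    have hgc : Continuous fun θ => ‖g ((R : ℂ) * uc θ)‖ ^ 2 :=
      (hg.continuous_circle hR1).norm.pow 2
    have h1 := ((hg.pow 2).diffContOnCl_ball_of_lt
      hR.2).two_pi_i_inv_smul_circleIntegral_sub_inv_smul (w := w) (by simpa using hR.1)
    rw [circleIntegral_eq_uc] at h1
    have h2 : ‖∫ θ in (0:ℝ)..(2 * Real.pi),
        (R * uc θ) * (((R * uc θ) - w)⁻¹ • (g ^ 2) (R * uc θ))‖ ≤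
        ∫ θ in (0:ℝ)..(2 * Real.pi), (R - ‖w‖)⁻¹ * ‖g ((R : ℂ) * uc θ)‖ ^ 2 := by
      refine intervalIntegral.norm_integral_le_of_norm_le Real.two_pi_pos.le
        (Eventually.of_forall fun θ _ => ?_) ((hgc.const_mul _).intervalIntegrable _ _)
      have h3 : R - ‖w‖ ≤ ‖R * uc θ - w‖ := by
        have := norm_sub_norm_le (R * uc θ) w
        rwa [norm_ofReal_mul_uc hR0.le] at this
      have h4 : 0 < R - ‖w‖ := sub_pos.2 hR.1
      simp only [smul_eq_mul, Pi.pow_apply]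
      rw [norm_mul, norm_ofReal_mul_uc hR0.le, norm_mul, norm_inv, norm_pow]
      have h5 : ‖R * uc θ - w‖⁻¹ ≤ (R - ‖w‖)⁻¹ := inv_anti₀ h4 h3
      calc R * (‖R * uc θ - w‖⁻¹ * ‖g (R * uc θ)‖ ^ 2)
          ≤ 1 * ((R - ‖w‖)⁻¹ * ‖g (R * uc θ)‖ ^ 2) := by
            gcongr; exact hR.2.le
        _ = _ := one_mul _
    rw [intervalIntegral.integral_const_mul] at h2
    have h4 : 0 < R - ‖w‖ := sub_pos.2 hR.1
    have h6 : ‖g w‖ ^ 2 ≤ (R - ‖w‖)⁻¹ * C := by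
      rw [← norm_pow, ← Pi.pow_apply g 2 w, ← h1, norm_smul, norm_mul]
      have hpi : ‖(2 * (Real.pi : ℂ) * I)⁻¹‖ ≤ 1 := by
        rw [norm_inv]
        refine inv_le_one_of_one_le₀ ?_
        simp only [norm_mul, norm_I, Complex.norm_real, Real.norm_eq_abs, abs_of_pos Real.pi_pos]
        norm_num
        linarith [Real.pi_gt_three]
      rw [norm_I, one_mul]
      refine (mul_le_of_le_one_left (norm_nonneg _) hpi).trans (h2.trans ?_)
      have := hC R hR1
      gcongr
    rw [inv_mul_eq_div, le_div_iff₀ h4] at h6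
    exact h6
  have hlim : Tendsto (fun R : ℝ => ‖g w‖ ^ 2 * (R - ‖w‖)) (nhdsWithin 1 (Set.Iio 1))
      (nhds (‖g w‖ ^ 2 * (1 - ‖w‖))) := by
    refine Tendsto.mono_left ?_ nhdsWithin_le_nhds
    exact ((continuous_id.sub continuous_const).const_mul _).tendsto 1
  refine le_of_tendsto hlim ?_
  filter_upwards [Ioo_mem_nhdsLT hw'] with R hR using key R hR

/-- A holomorphic function with square-integrable growth has a bounded primitive with radial
limits everywhere on the unit circle. -/
lemma exists_bounded_primitive {g : ℂ → ℂ} (hg : MemH2 g) :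
    ∃ A : ℂ → ℂ, (∀ z ∈ unitDisk, HasDerivAt A (g z) z) ∧ (∃ M, ∀ z ∈ unitDisk, ‖A z‖ ≤ M) ∧
      ∀ θ, ∃ l, Tendsto (fun r : ℝ => A (r * uc θ)) (nhdsWithin 1 (Set.Iio 1)) (nhds l) := by
  obtain ⟨hd, C, hC⟩ := hg
  obtain ⟨A, hA⟩ := DifferentiableOn.isExactOn_ball hd
  have hA' : ∀ z ∈ unitDisk, HasDerivAt A (g z) z := hA
  obtain ⟨K, hK0, hK⟩ : ∃ K, 0 ≤ K ∧ ∀ z ∈ unitDisk, ‖g z‖ ≤ K / √(1 - ‖z‖) := by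
    refine ⟨√C, Real.sqrt_nonneg _, fun z hz => ?_⟩
    have h1 := norm_sq_mul_one_sub_le hd hC hz
    have h2 : 0 < 1 - ‖z‖ := sub_pos.2 (mem_unitDisk.1 hz)
    rw [le_div_iff₀ (Real.sqrt_pos.2 h2)]
    refine Real.le_sqrt_of_sq_le ?_
    rwa [mul_pow, Real.sq_sqrt h2.le]
  have hder : ∀ θ, ∀ r ∈ Set.Ico (0 : ℝ) 1,
      HasDerivAt (fun r : ℝ => A (r * uc θ)) (g (r * uc θ) * uc θ) r := by
    intro θ r hr
    have h1 : HasDerivAt (fun r : ℝ => (r : ℂ) * uc θ) (uc θ) r := by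
      simpa using (Complex.ofRealCLM.hasDerivAt (x := r)).mul_const (uc θ)
    exact (hA' _ (ofReal_mul_uc_mem hr θ)).comp r h1
  have hdist : ∀ θ s r : ℝ, 0 ≤ s → s ≤ r → r < 1 →
      ‖A (r * uc θ) - A (s * uc θ)‖ ≤ 2 * K * (√(1 - s) - √(1 - r)) := by
    intro θ s r hs hsr hr
    have hB : ∀ x ∈ Set.Ico s r, HasDerivAt (fun x => 2 * K * (√(1 - s) - √(1 - x)))
        (K / √(1 - x)) x := by
      intro x hx
      have h2 : (1 - x) ≠ 0 := by linarith [hx.2]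
      have h1 := (((hasDerivAt_id x).const_sub 1).sqrt h2).const_sub (√(1 - s)) |>.const_mul (2 * K)
      refine h1.congr_deriv ?_
      simp only [id]
      field_simp
    refine image_norm_le_of_norm_deriv_right_le_deriv_boundary' (a := s) (b := r)
      (f := fun x : ℝ => A (x * uc θ) - A (s * uc θ)) (f' := fun x => g (x * uc θ) * uc θ)
      (B := fun x => 2 * K * (√(1 - s) - √(1 - x))) (B' := fun x => K / √(1 - x))
      ?_ ?_ ?_ ?_ ?_ ?_ (Set.right_mem_Icc.2 hsr)
    · intro x hx
      exact ((hder θ x ⟨hs.trans hx.1, hx.2.trans_lt hr⟩).sub_const _).continuousAt.continuousWithinAt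
    · intro x hx
      exact ((hder θ x ⟨hs.trans hx.1, hx.2.trans hr⟩).sub_const _).hasDerivWithinAt
    · simp
    · fun_prop
    · intro x hx
      exact (hB x hx).hasDerivWithinAt
    · intro x hx
      have hx1 : x ∈ Set.Ico (0 : ℝ) 1 := ⟨hs.trans hx.1, hx.2.trans hr⟩
      have := hK _ (ofReal_mul_uc_mem hx1 θ)
      rw [norm_mul, norm_uc, mul_one]
      rwa [norm_ofReal_mul_uc hx1.1] at this
  refine ⟨A, hA', ⟨‖A 0‖ + 2 * K, fun z hz => ?_⟩, fun θ => ?_⟩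
  · have hz' := mem_unitDisk.1 hz
    have hzu : z = (‖z‖ : ℂ) * uc z.arg := by
      rw [uc, Complex.norm_mul_exp_arg_mul_I]
    have h1 := hdist z.arg 0 ‖z‖ le_rfl (norm_nonneg z) hz'
    rw [← hzu] at h1
    simp only [Complex.ofReal_zero, zero_mul, sub_zero, Real.sqrt_one] at h1
    have h2 : 2 * K * (1 - √(1 - ‖z‖)) ≤ 2 * K := by
      have := Real.sqrt_nonneg (1 - ‖z‖)
      nlinarith
    have h3 := norm_sub_norm_le (A z) (A 0)
    linarith
  · refine cauchy_map_iff_exists_tendsto.1 ?_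
    refine Metric.cauchy_iff.2 ⟨inferInstance, fun ε hε => ?_⟩
    have hlim : Tendsto (fun r : ℝ => 2 * K * √(1 - r)) (nhdsWithin 1 (Set.Iio 1)) (nhds 0) := by
      have : Continuous fun r : ℝ => 2 * K * √(1 - r) := by fun_prop
      simpa using (this.tendsto 1).mono_left nhdsWithin_le_nhds
    have hev := (hlim.eventually_lt_const hε).and (Ioo_mem_nhdsLT (zero_lt_one' ℝ))
    refine ⟨_, Filter.image_mem_map hev, ?_⟩
    have main : ∀ s r : ℝ, 0 ≤ s → s ≤ r → r < 1 → 2 * K * √(1 - s) < ε →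
        dist (A (r * uc θ)) (A (s * uc θ)) < ε := by
      intro s r hs hsr hr hlt
      rw [dist_eq_norm]
      refine (hdist θ s r hs hsr hr).trans_lt (lt_of_le_of_lt ?_ hlt)
      have := Real.sqrt_nonneg (1 - r)
      nlinarith
    rintro _ ⟨s, ⟨hs1, hs2⟩, rfl⟩ _ ⟨r, ⟨hr1, hr2⟩, rfl⟩
    rcases le_total s r with h | h
    · rw [dist_comm]; exact main s r hs2.1.le h hr2.2 hs1
    · exact main r s hr2.1.le h hs2.2 hr1

lemma continuous_poissonDeriv {r : ℝ} (hr : r ∈ Set.Ico (0 : ℝ) 1) :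
    Continuous (poissonDeriv r) := by
  have h1 : ∀ t, ‖1 - r * uc t‖ ^ 4 ≠ 0 := fun t =>
    pow_ne_zero _ (norm_ne_zero_iff.2 (one_sub_mul_uc_ne_zero hr t))
  have h2 := continuous_uc
  unfold poissonDeriv
  refine continuous_const.mul (Complex.continuous_ofReal.comp ?_)
  exact (continuous_const.mul Real.continuous_sin).div (by fun_prop) h1

lemma deriv_eq_integral_poissonDeriv_of_closedBall {F : ℂ → ℂ} {U : Set ℂ} (hU : IsOpen U)
    (hF : DifferentiableOn ℂ F U) (hc : Metric.closedBall 0 1 ⊆ U) {r : ℝ}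
    (hr : r ∈ Set.Ico (0 : ℝ) 1) :
    2 * Real.pi * deriv F r = ∫ t in (0:ℝ)..(2 * Real.pi), F (uc t) * poissonDeriv r t := by
  have hr' : (r : ℂ) ∈ Metric.ball (0 : ℂ) 1 := by
    simpa [abs_of_nonneg hr.1] using hr.2
  have h1 := two_pi_I_inv_smul_circleIntegral_sub_sq_inv_smul_of_differentiable hU hc hF hr'
  have hdiff : DifferentiableOn ℂ (fun z => F z / (1 - r * z) ^ 2) (Metric.closedBall 0 1) := by
    refine (hF.mono hc).fun_div (by fun_prop) fun z hz => pow_ne_zero _ fun h => ?_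
    have h3 : (1 : ℂ) = r * z := sub_eq_zero.1 h
    have h4 : ‖(r : ℂ) * z‖ < 1 := by
      rw [norm_mul, Complex.norm_of_nonneg hr.1]
      have : ‖z‖ ≤ 1 := by simpa using hz
      nlinarith [hr.1, hr.2, norm_nonneg z]
    rw [← h3, norm_one] at h4
    exact lt_irrefl _ h4
  have h2 := (hdiff.diffContOnCl_ball subset_rfl).circleIntegral_eq_zero zero_le_one
  rw [circleIntegral_eq_uc] at h1 h2
  have h2' := (mul_eq_zero.1 h2).resolve_left I_ne_zero
  have hFc : Continuous fun t => F (uc t) := by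
    refine (hF.continuousOn.mono hc).comp_continuous continuous_uc fun t => ?_
    simp [norm_uc]
  have hk1 : Continuous fun t => uc t / (1 - r * uc t) ^ 2 := by
    have := continuous_uc
    exact this.div (by fun_prop) fun t => pow_ne_zero _ (one_sub_mul_uc_ne_zero hr t)
  have hsplit : ∀ t, F (uc t) * poissonDeriv r t =
      (uc t * (((uc t - r) ^ 2)⁻¹ * F (uc t))) - uc t * (F (uc t) / (1 - r * uc t) ^ 2) := by
    intro t; rw [poissonDeriv_eq hr]; ring
  have hi2 : Continuous fun t => uc t * (F (uc t) / (1 - r * uc t) ^ 2) := by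
    refine (hFc.mul hk1).congr fun t => ?_
    simp only [Pi.mul_apply]; ring
  have hi1 : Continuous fun t => uc t * (((uc t - r) ^ 2)⁻¹ * F (uc t)) := by
    refine ((hFc.mul (continuous_poissonDeriv hr)).add hi2).congr fun t => ?_
    simp only [Pi.mul_apply, Pi.add_apply, hsplit]; ring
  simp only [hsplit]
  simp only [Complex.ofReal_one, one_mul, smul_eq_mul] at h1 h2'
  rw [intervalIntegral.integral_sub (hi1.intervalIntegrable _ _) (hi2.intervalIntegrable _ _), h2',
    ← h1]
  have := Real.pi_ne_zero
  field_simp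
  ring

lemma integral_poissonDeriv_eq {A g : ℂ → ℂ} (hg : DifferentiableOn ℂ g unitDisk)
    (hA : ∀ z ∈ unitDisk, HasDerivAt A (g z) z) {M : ℝ} (hM : ∀ z ∈ unitDisk, ‖A z‖ ≤ M)
    {a : ℝ → ℂ}
    (ha : ∀ θ, Tendsto (fun r : ℝ => A (r * uc θ)) (nhdsWithin 1 (Set.Iio 1)) (nhds (a θ)))
    {r : ℝ} (hr : r ∈ Set.Ico (0 : ℝ) 1) :
    2 * Real.pi * g r = ∫ t in (-Real.pi)..Real.pi, a t * poissonDeriv r t := by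
  have hAd : DifferentiableOn ℂ A unitDisk := fun z hz =>
    (hA z hz).differentiableAt.differentiableWithinAt
  have hr0 : (r : ℂ) ∈ unitDisk := by rw [mem_unitDisk, Complex.norm_of_nonneg hr.1]; exact hr.2
  have hev : ∀ᶠ ρ : ℝ in nhdsWithin 1 (Set.Iio 1), ρ ∈ Set.Ioo (0 : ℝ) 1 :=
    Ioo_mem_nhdsLT zero_lt_one
  have hper : Function.Periodic (fun t => a t * poissonDeriv r t) (2 * Real.pi) := by
    intro t
    have h1 : a (t + 2 * Real.pi) = a t := by
      refine tendsto_nhds_unique (ha _) ?_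
      simpa only [uc_periodic t] using ha t
    simp only [h1, poissonDeriv_eq hr, uc_periodic t]
  have hint : ∫ t in (-Real.pi)..Real.pi, a t * poissonDeriv r t =
      ∫ t in (0:ℝ)..(2 * Real.pi), a t * poissonDeriv r t := by
    have := hper.intervalIntegral_add_eq (-Real.pi) 0
    rw [zero_add, show -Real.pi + 2 * Real.pi = Real.pi by ring] at this
    exact this
  rw [hint]
  have hL : Tendsto (fun ρ : ℝ => 2 * Real.pi * (g (ρ * r) * ρ)) (nhdsWithin 1 (Set.Iio 1))
      (nhds (2 * Real.pi * g r)) := by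
    have hgc : ContinuousAt g ((1 : ℝ) * r) := by
      rw [Complex.ofReal_one, one_mul]
      exact (hg.differentiableAt (Metric.isOpen_ball.mem_nhds hr0)).continuousAt
    have h1 : Tendsto (fun ρ : ℝ => (ρ : ℂ) * r) (nhds 1) (nhds ((1 : ℝ) * r)) :=
      (Complex.continuous_ofReal.mul continuous_const).tendsto 1
    have h2 := ((hgc.tendsto.comp h1).mul (Complex.continuous_ofReal.tendsto 1)).const_mul
      (2 * Real.pi : ℂ)
    simp only [Complex.ofReal_one, one_mul, mul_one] at h2
    exact h2.mono_left nhdsWithin_le_nhds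
  have hR : Tendsto (fun ρ : ℝ => ∫ t in (0:ℝ)..(2 * Real.pi), A (ρ * uc t) * poissonDeriv r t)
      (nhdsWithin 1 (Set.Iio 1))
      (nhds (∫ t in (0:ℝ)..(2 * Real.pi), a t * poissonDeriv r t)) := by
    refine intervalIntegral.tendsto_integral_filter_of_dominated_convergence
      (fun t => M * ‖poissonDeriv r t‖) ?_ ?_ ?_ ?_
    · filter_upwards [hev] with ρ hρ
      exact ((hAd.continuous_circle ⟨hρ.1.le, hρ.2⟩).mul
        (continuous_poissonDeriv hr)).aestronglyMeasurable
    · filter_upwards [hev] with ρ hρ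
      refine Eventually.of_forall fun t _ => ?_
      rw [norm_mul]
      have := hM _ (ofReal_mul_uc_mem ⟨hρ.1.le, hρ.2⟩ t)
      gcongr
    · exact ((continuous_poissonDeriv hr).norm.const_mul M).intervalIntegrable _ _
    · exact Eventually.of_forall fun t _ => (ha t).mul_const _
  refine tendsto_nhds_unique hL (hR.congr' ?_)
  filter_upwards [hev] with ρ hρ
  have hsub : ∀ z ∈ Metric.ball (0 : ℂ) ρ⁻¹, (ρ : ℂ) * z ∈ unitDisk := by
    intro z hz
    have hz' : ‖z‖ < ρ⁻¹ := by simpa using hz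
    rw [mem_unitDisk, norm_mul, Complex.norm_of_nonneg hρ.1.le]
    calc ρ * ‖z‖ < ρ * ρ⁻¹ := by have := hρ.1; gcongr
      _ = 1 := mul_inv_cancel₀ hρ.1.ne'
  have hd : ∀ z ∈ Metric.ball (0 : ℂ) ρ⁻¹,
      HasDerivAt (fun z => A (ρ * z)) (g (ρ * z) * ρ) z := by
    intro z hz
    have h1 : HasDerivAt (fun z : ℂ => (ρ : ℂ) * z) (ρ : ℂ) z := by
      simpa using (hasDerivAt_id z).const_mul (ρ : ℂ)
    exact (hA _ (hsub z hz)).comp z h1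
  have hlt : 1 < ρ⁻¹ := (one_lt_inv₀ hρ.1).2 hρ.2
  have h1 := deriv_eq_integral_poissonDeriv_of_closedBall (F := fun z => A (ρ * z))
    Metric.isOpen_ball (fun z hz => (hd z hz).differentiableAt.differentiableWithinAt)
    (Metric.closedBall_subset_ball hlt) hr
  rw [← h1, (hd r (Metric.ball_subset_ball hlt.le hr0)).deriv]

lemma abs_le_pi_mul_norm_one_sub {r : ℝ} (hr : r ∈ Set.Ico (0 : ℝ) 1) {t : ℝ}
    (ht : |t| ≤ Real.pi) : |t| ≤ Real.pi * ‖1 - r * uc t‖ := by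
  have hpi := Real.pi_pos
  have h1 : ‖uc t - 1‖ = 2 * |Real.sin (t / 2)| := by
    rw [uc, mul_comm, Complex.norm_exp_I_mul_ofReal_sub_one, norm_mul]
    simp
  have h2 : 2 / Real.pi * |t / 2| ≤ |Real.sin (t / 2)| := by
    refine Real.mul_abs_le_abs_sin ?_
    rw [abs_div, abs_two]; linarith
  rw [abs_div, abs_two] at h2
  have h3 : 1 - r ≤ ‖1 - r * uc t‖ := by
    have := norm_sub_norm_le 1 (r * uc t)
    rwa [norm_one, norm_ofReal_mul_uc hr.1] at this
  have h4 : ‖uc t - 1‖ ≤ (1 - r) + ‖1 - r * uc t‖ := by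
    have h5 : uc t - 1 = ((1 - r : ℝ) : ℂ) * uc t - (1 - r * uc t) := by push_cast; ring
    rw [h5]
    refine (norm_sub_le _ _).trans (le_of_eq ?_)
    rw [norm_ofReal_mul_uc (by linarith [hr.2])]
  have h6 : 2 / Real.pi * (|t| / 2) ≤ ‖1 - r * uc t‖ := by linarith
  have h7 : |t| = Real.pi * (2 / Real.pi * (|t| / 2)) := by field_simp
  rw [h7]
  gcongr

lemma integral_poisson {r : ℝ} (hr : r ∈ Set.Ico (0 : ℝ) 1) :
    ∫ t in (-Real.pi)..Real.pi, (1 - r ^ 2) / ‖1 - r * uc t‖ ^ 2 = 2 * Real.pi := by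
  have hper : Function.Periodic (fun t => (1 - r ^ 2) / ‖1 - r * uc t‖ ^ 2) (2 * Real.pi) := by
    intro t
    simp only [uc_periodic t]
  have h1 := hper.intervalIntegral_add_eq (-Real.pi) 0
  rw [zero_add, show -Real.pi + 2 * Real.pi = Real.pi by ring] at h1
  rw [h1]
  have h2 := DiffContOnCl.circleAverage_poissonKernel_smul' (c := 0) (R := 1) (w := (r : ℂ))
    (f := fun _ => (1 : ℂ)) diffContOnCl_const (by simpa [abs_of_nonneg hr.1] using hr.2)
  rw [Real.circleAverage_def] at h2
  have h3 : ∀ t, ‖circleMap 0 1 t - 0 - (r - 0)‖ = ‖1 - r * uc t‖ := by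
    intro t
    have h4 : circleMap 0 1 t - 0 - (r - 0) = uc t * (starRingEnd ℂ) (1 - r * uc t) := by
      have := uc_ne_zero t
      simp only [map_sub, map_one, map_mul, conj_uc, Complex.conj_ofReal]
      simp only [circleMap, uc] at this ⊢
      field_simp
      simp
    rw [h4, norm_mul, norm_uc, Complex.norm_conj, one_mul]
  simp only [h3] at h2
  simp only [sub_zero, norm_circleMap_zero, abs_one, one_pow, Complex.norm_real, Real.norm_eq_abs,
    sq_abs, Complex.real_smul, mul_one, intervalIntegral.integral_ofReal] at h2
  have h5 : (2 * Real.pi)⁻¹ * ∫ t in (0:ℝ)..(2 * Real.pi), (1 - r ^ 2) / ‖1 - r * uc t‖ ^ 2 = 1 := by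
    exact_mod_cast h2
  have := Real.pi_pos
  rw [inv_mul_eq_one₀ (by positivity)] at h5
  exact h5.symm

lemma norm_poissonDeriv_mul_le {r : ℝ} (hr : r ∈ Set.Ico (0 : ℝ) 1) {ε N t : ℝ} (hε : 0 ≤ ε)
    (hN : 0 ≤ N) (ht : |t| ≤ Real.pi) :
    (ε * |t| + N * |t| ^ 3) * ‖poissonDeriv r t‖ ≤
      2 * Real.pi ^ 2 * ε * ((1 - r ^ 2) / ‖1 - r * uc t‖ ^ 2) +
        2 * Real.pi ^ 4 * N * (1 - r ^ 2) := by
  have h1 : 0 < ‖1 - r * uc t‖ := norm_pos_iff.2 (one_sub_mul_uc_ne_zero hr t)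
  have h2 := abs_le_pi_mul_norm_one_sub hr ht
  have h3 : 0 ≤ 1 - r ^ 2 := by nlinarith [hr.1, hr.2]
  have h4 : ‖poissonDeriv r t‖ ≤ 2 * ((1 - r ^ 2) * |t| / ‖1 - r * uc t‖ ^ 4) := by
    rw [poissonDeriv, norm_mul, Complex.norm_real, Real.norm_eq_abs, abs_div, abs_mul,
      abs_of_nonneg h3, abs_of_pos (pow_pos h1 4)]
    have h5 : |Real.sin t| ≤ |t| := Real.abs_sin_le_abs
    have h6 : ‖-2 * I‖ = 2 := by simp
    rw [h6]
    gcongr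
  generalize ‖1 - r * uc t‖ = n at *
  have h5 : |t| ^ 2 ≤ (Real.pi * n) ^ 2 := by gcongr
  have h6 : |t| ^ 4 ≤ (Real.pi * n) ^ 4 := by gcongr
  calc (ε * |t| + N * |t| ^ 3) * ‖poissonDeriv r t‖
      ≤ (ε * |t| + N * |t| ^ 3) * (2 * ((1 - r ^ 2) * |t| / n ^ 4)) := by gcongr
    _ = 2 * (1 - r ^ 2) / n ^ 4 * (ε * |t| ^ 2 + N * |t| ^ 4) := by ring
    _ ≤ 2 * (1 - r ^ 2) / n ^ 4 * (ε * (Real.pi * n) ^ 2 + N * (Real.pi * n) ^ 4) := by gcongr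
    _ = _ := by field_simp

lemma tendsto_zero_of_hasDerivAt_zero {A g : ℂ → ℂ} (hg : DifferentiableOn ℂ g unitDisk)
    (hA : ∀ z ∈ unitDisk, HasDerivAt A (g z) z) {M : ℝ} (hM : ∀ z ∈ unitDisk, ‖A z‖ ≤ M)
    {a : ℝ → ℂ}
    (ha : ∀ θ, Tendsto (fun r : ℝ => A (r * uc θ)) (nhdsWithin 1 (Set.Iio 1)) (nhds (a θ)))
    (ha0 : a 0 = 0) (had : HasDerivAt a 0 0) :
    Tendsto (fun r : ℝ => g r) (nhdsWithin 1 (Set.Iio 1)) (nhds 0) := by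
  have hpi := Real.pi_pos
  have hev : ∀ᶠ ρ : ℝ in nhdsWithin 1 (Set.Iio 1), ρ ∈ Set.Ioo (0 : ℝ) 1 :=
    Ioo_mem_nhdsLT zero_lt_one
  have haM : ∀ t, ‖a t‖ ≤ M := fun t => by
    refine le_of_tendsto (ha t).norm ?_
    filter_upwards [hev] with ρ hρ using hM _ (ofReal_mul_uc_mem ⟨hρ.1.le, hρ.2⟩ t)
  have hM0 : 0 ≤ M := (norm_nonneg _).trans (haM 0)
  rw [NormedAddGroup.tendsto_nhds_zero]
  intro η hη
  set ε := η / (4 * Real.pi ^ 2) with hεd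
  have hε : 0 < ε := by positivity
  obtain ⟨δ, hδ, hδt⟩ : ∃ δ > 0, ∀ t, |t| < δ → ‖a t‖ ≤ ε * |t| := by
    have h1 := (hasDerivAt_iff_isLittleO.1 had).def hε
    obtain ⟨δ, hδ, h2⟩ := Metric.eventually_nhds_iff.1 h1
    refine ⟨δ, hδ, fun t ht => ?_⟩
    have := h2 (y := t) (by simpa using ht)
    simpa [ha0] using this
  set N := M / δ ^ 3 with hN
  have hN0 : 0 ≤ N := by positivity
  have hbound : ∀ t, ‖a t‖ ≤ ε * |t| + N * |t| ^ 3 := by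
    intro t
    rcases lt_or_ge |t| δ with h | h
    · exact (hδt t h).trans (le_add_of_nonneg_right (by positivity))
    · calc ‖a t‖ ≤ M := haM t
        _ = N * δ ^ 3 := by rw [hN]; field_simp
        _ ≤ N * |t| ^ 3 := by gcongr
        _ ≤ _ := le_add_of_nonneg_left (by positivity)
  have hlim : Tendsto (fun r : ℝ => 2 * Real.pi ^ 2 * ε + 2 * Real.pi ^ 4 * N * (1 - r ^ 2))
      (nhdsWithin 1 (Set.Iio 1)) (nhds (η / 2)) := by
    have h1 : Continuous fun r : ℝ => 2 * Real.pi ^ 2 * ε + 2 * Real.pi ^ 4 * N * (1 - r ^ 2) := by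
      fun_prop
    have h2 := (h1.tendsto 1).mono_left (nhdsWithin_le_nhds (s := Set.Iio 1))
    convert h2 using 2
    rw [hεd]; field_simp; ring
  filter_upwards [hev, hlim.eventually_lt_const (half_lt_self hη)] with r hr hlt
  have hr' : r ∈ Set.Ico (0 : ℝ) 1 := ⟨hr.1.le, hr.2⟩
  refine lt_of_le_of_lt ?_ hlt
  have hrep := integral_poissonDeriv_eq hg hA hM ha hr'
  have hPc : Continuous fun t => (1 - r ^ 2) / ‖1 - r * uc t‖ ^ 2 := by
    have := continuous_uc
    exact continuous_const.div (by fun_prop) fun t =>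
      pow_ne_zero _ (norm_ne_zero_iff.2 (one_sub_mul_uc_ne_zero hr' t))
  have hle : ‖∫ t in (-Real.pi)..Real.pi, a t * poissonDeriv r t‖ ≤
      ∫ t in (-Real.pi)..Real.pi, (2 * Real.pi ^ 2 * ε * ((1 - r ^ 2) / ‖1 - r * uc t‖ ^ 2) +
        2 * Real.pi ^ 4 * N * (1 - r ^ 2)) := by
    refine intervalIntegral.norm_integral_le_of_norm_le (by linarith)
      (Eventually.of_forall fun t ht => ?_)
      (((hPc.const_mul _).add continuous_const).intervalIntegrable _ _)
    rw [norm_mul]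
    refine le_trans ?_ (norm_poissonDeriv_mul_le hr' hε.le hN0 (abs_le.2 ⟨ht.1.le, ht.2⟩))
    exact mul_le_mul_of_nonneg_right (hbound t) (norm_nonneg _)
  rw [intervalIntegral.integral_add ((hPc.const_mul _).intervalIntegrable _ _)
    intervalIntegrable_const, intervalIntegral.integral_const_mul, integral_poisson hr',
    intervalIntegral.integral_const, ← hrep, norm_mul, norm_mul, Complex.norm_real,
    Real.norm_eq_abs, abs_of_pos hpi, smul_eq_mul] at hle
  have h2 : ‖(2 : ℂ)‖ = 2 := by simp
  rw [h2] at hle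
  refine le_of_mul_le_mul_left (hle.trans (le_of_eq ?_)) Real.two_pi_pos
  ring

lemma exists_tendsto_of_differentiableAt_zero {A g : ℂ → ℂ} (hg : DifferentiableOn ℂ g unitDisk)
    (hA : ∀ z ∈ unitDisk, HasDerivAt A (g z) z) {M : ℝ} (hM : ∀ z ∈ unitDisk, ‖A z‖ ≤ M)
    {a : ℝ → ℂ}
    (ha : ∀ θ, Tendsto (fun r : ℝ => A (r * uc θ)) (nhdsWithin 1 (Set.Iio 1)) (nhds (a θ)))
    (had : DifferentiableAt ℝ a 0) :
    ∃ l, Tendsto (fun r : ℝ => g r) (nhdsWithin 1 (Set.Iio 1)) (nhds l) := by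
  set D := deriv a 0
  have hD : HasDerivAt a D 0 := had.hasDerivAt
  have hder : HasDerivAt (fun t => a t - a 0 + I * D * (uc t - 1)) 0 0 := by
    have h1 := (hD.sub_const (a 0)).add (((hasDerivAt_uc 0).sub_const 1).const_mul (I * D))
    refine h1.congr_deriv ?_
    rw [uc_zero]
    linear_combination D * I_mul_I
  have h := tendsto_zero_of_hasDerivAt_zero (g := fun z => g z + I * D)
    (A := fun z => A z - a 0 + I * D * (z - 1)) (a := fun t => a t - a 0 + I * D * (uc t - 1))
    (M := M + ‖a 0‖ + ‖I * D‖ * 2) (by fun_prop) ?_ ?_ ?_ (by simp [uc_zero]) hder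
  · refine ⟨0 - I * D, ?_⟩
    simpa using h.sub_const (I * D)
  · intro z hz
    have h1 := ((hA z hz).sub_const (a 0)).add (((hasDerivAt_id z).sub_const 1).const_mul (I * D))
    exact h1.congr_deriv (by ring)
  · intro z hz
    have hz' := mem_unitDisk.1 hz
    refine (norm_add_le _ _).trans (add_le_add ((norm_sub_le _ _).trans ?_) ?_)
    · gcongr; exact hM z hz
    · rw [norm_mul]
      gcongr
      refine (norm_sub_le _ _).trans ?_
      rw [norm_one]; linarith
  · intro θ
    refine ((ha θ).sub_const _).add (Tendsto.const_mul _ (Tendsto.sub_const ?_ _))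
    have h1 : Continuous fun r : ℝ => (r : ℂ) * uc θ := by fun_prop
    simpa using (h1.tendsto 1).mono_left (nhdsWithin_le_nhds (s := Set.Iio 1))

lemma MemH2.integral_norm_le {g : ℂ → ℂ} (hg : MemH2 g) :
    ∃ K, ∀ r ∈ Set.Ico (0 : ℝ) 1,
      (∫ θ in (0:ℝ)..(2 * Real.pi), ‖g ((r : ℂ) * uc θ)‖) ≤ K := by
  obtain ⟨hd, C, hC⟩ := hg
  refine ⟨2 * Real.pi + C, fun r hr => ?_⟩
  have hc := hd.continuous_circle hr
  calc (∫ θ in (0:ℝ)..(2 * Real.pi), ‖g ((r : ℂ) * uc θ)‖)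
      ≤ ∫ θ in (0:ℝ)..(2 * Real.pi), (1 + ‖g ((r : ℂ) * uc θ)‖ ^ 2) := by
        refine intervalIntegral.integral_mono_on Real.two_pi_pos.le
          (hc.norm.intervalIntegrable _ _)
          ((continuous_const.add (hc.norm.pow 2)).intervalIntegrable _ _) fun θ _ => ?_
        nlinarith [sq_nonneg (‖g (r * uc θ)‖ - 1)]
    _ = 2 * Real.pi + ∫ θ in (0:ℝ)..(2 * Real.pi), ‖g ((r : ℂ) * uc θ)‖ ^ 2 := by
        have hc2 : Continuous fun θ => ‖g (r * uc θ)‖ ^ 2 := hc.norm.pow 2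
        rw [intervalIntegral.integral_add intervalIntegrable_const (hc2.intervalIntegrable _ _)]
        simp
    _ ≤ _ := by gcongr; exact hC r hr

lemma boundedVariationOn_radial_limit {A g : ℂ → ℂ} (hg : MemH2 g)
    (hA : ∀ z ∈ unitDisk, HasDerivAt A (g z) z) {a : ℝ → ℂ}
    (ha : ∀ θ, Tendsto (fun r : ℝ => A (r * uc θ)) (nhdsWithin 1 (Set.Iio 1)) (nhds (a θ))) :
    BoundedVariationOn a (Set.uIcc 0 (2 * Real.pi)) := by
  obtain ⟨K, hK⟩ := hg.integral_norm_le
  have hseg : ∀ r ∈ Set.Ico (0 : ℝ) 1, ∀ s t : ℝ, s ≤ t →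
      dist (A (r * uc t)) (A (r * uc s)) ≤ ∫ θ in s..t, ‖g (r * uc θ)‖ := by
    intro r hr s t hst
    have hder : ∀ θ, HasDerivAt (fun θ : ℝ => A (r * uc θ))
        (g (r * uc θ) * (r * (uc θ * I))) θ := fun θ =>
      (hA _ (ofReal_mul_uc_mem hr θ)).comp θ ((hasDerivAt_uc θ).const_mul (r : ℂ))
    have hc := hg.1.continuous_circle hr
    have huc := continuous_uc
    have hc' : Continuous fun θ => g (r * uc θ) * (r * (uc θ * I)) := hc.mul (by fun_prop)
    rw [dist_eq_norm, ← intervalIntegral.integral_eq_sub_of_hasDerivAt (fun θ _ => hder θ)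
      (hc'.intervalIntegrable _ _)]
    refine intervalIntegral.norm_integral_le_of_norm_le hst (Eventually.of_forall fun θ _ => ?_)
      (hc.norm.intervalIntegrable _ _)
    rw [norm_mul, ← mul_assoc, norm_mul, norm_I, mul_one, norm_ofReal_mul_uc hr.1]
    exact mul_le_of_le_one_right (norm_nonneg _) hr.2.le
  refine ne_top_of_le_ne_top (ENNReal.ofReal_ne_top (r := K)) (iSup_le ?_)
  rintro ⟨n, u, hu, hus⟩
  simp only [edist_dist]
  rw [← ENNReal.ofReal_sum_of_nonneg fun _ _ => dist_nonneg]
  refine ENNReal.ofReal_le_ofReal ?_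
  have hlim : Tendsto (fun r : ℝ => ∑ i ∈ Finset.range n,
      dist (A (r * uc (u (i + 1)))) (A (r * uc (u i)))) (nhdsWithin 1 (Set.Iio 1))
      (nhds (∑ i ∈ Finset.range n, dist (a (u (i + 1))) (a (u i)))) :=
    tendsto_finsetSum _ fun i _ => (ha _).dist (ha _)
  refine le_of_tendsto hlim ?_
  filter_upwards [Ioo_mem_nhdsLT (zero_lt_one' ℝ)] with r hr
  have hr' : r ∈ Set.Ico (0 : ℝ) 1 := ⟨hr.1.le, hr.2⟩
  have hc := (hg.1.continuous_circle hr').norm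
  refine (Finset.sum_le_sum fun i _ => hseg r hr' _ _ (hu i.le_succ)).trans ?_
  rw [intervalIntegral.sum_integral_adjacent_intervals fun i _ => hc.intervalIntegrable _ _]
  rw [Set.uIcc_of_le Real.two_pi_pos.le] at hus
  refine le_trans ?_ (hK r hr')
  exact intervalIntegral.integral_mono_interval (hus 0).1 (hu n.zero_le) (hus n).2
    (Eventually.of_forall fun _ => norm_nonneg _) (hc.intervalIntegrable _ _)

/-- **Fatou's theorem**: functions in the Hardy space `H²` have radial limits almost everywhere. -/
theorem MemH2.ae_tendsto_bdry {g : ℂ → ℂ} (hg : MemH2 g) :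
    ∀ᵐ θ ∂bMeasure, Tendsto (fun r : ℝ => g (r * uc θ)) (nhdsWithin 1 (Set.Iio 1))
      (nhds (bdry g θ)) := by
  obtain ⟨A, hA, ⟨M, hM⟩, hlim⟩ := exists_bounded_primitive hg
  choose a ha using hlim
  have hbv := (boundedVariationOn_radial_limit hg hA ha).ae_differentiableAt_of_mem_uIcc
  rw [bMeasure, ae_restrict_iff' measurableSet_Ioc]
  filter_upwards [hbv] with θ hθ hmem
  have hdiff := hθ (by
    rw [Set.uIcc_of_le Real.two_pi_pos.le]; exact Set.Ioc_subset_Icc_self hmem)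
  have hrot : ∀ z ∈ unitDisk, uc θ * z ∈ unitDisk := fun z hz => by
    rw [mem_unitDisk, norm_mul, norm_uc, one_mul]; exact mem_unitDisk.1 hz
  have hmul : ∀ z, HasDerivAt (fun z => uc θ * z) (uc θ) z := fun z => by
    simpa using (hasDerivAt_id z).const_mul (uc θ)
  obtain ⟨l, hl⟩ := exists_tendsto_of_differentiableAt_zero (g := fun z => g (uc θ * z))
    (A := fun z => (uc θ)⁻¹ * A (uc θ * z)) (a := fun t => (uc θ)⁻¹ * a (θ + t)) (M := M)
    (hg.1.comp (fun z _ => (hmul z).differentiableAt.differentiableWithinAt) hrot)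
    (fun z hz => (((hA _ (hrot z hz)).comp z (hmul z)).const_mul (uc θ)⁻¹).congr_deriv (by
      have := uc_ne_zero θ
      field_simp))
    (fun z hz => by
      rw [norm_mul, norm_inv, norm_uc, inv_one, one_mul]; exact hM _ (hrot z hz))
    (fun t => by
      refine Tendsto.const_mul _ ((ha (θ + t)).congr fun r => ?_)
      rw [uc_add]; ring_nf)
    (by
      refine DifferentiableAt.const_mul ?_ _
      refine DifferentiableAt.comp (0 : ℝ) (g := a) (f := fun t => θ + t) ?_ (by fun_prop)
      simpa using hdiff)
  have hl' : Tendsto (fun r : ℝ => g (r * uc θ)) (nhdsWithin 1 (Set.Iio 1)) (nhds l) :=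
    hl.congr fun r => by rw [mul_comm]
  exact tendsto_nhds_limUnder ⟨l, hl'⟩

instance isFiniteMeasure_bMeasure : IsFiniteMeasure bMeasure := by
  unfold bMeasure; infer_instance

lemma tendsto_integral_of_lintegral_sq_le {α : Type*} [MeasurableSpace α] {μ : Measure α}
    [IsFiniteMeasure μ] {F : ℕ → α → ℂ} {h : α → ℂ} {K : NNReal}
    (hF : ∀ n, AEStronglyMeasurable (F n) μ) (hK : ∀ n, ∫⁻ x, ‖F n x‖ₑ ^ 2 ∂μ ≤ K)
    (hlim : ∀ᵐ x ∂μ, Tendsto (fun n => F n x) atTop (nhds (h x))) :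
    Tendsto (fun n => ∫ x, F n x ∂μ) atTop (nhds (∫ x, h x ∂μ)) := by
  have hui : UniformIntegrable F 1 μ := by
    refine uniformIntegrable_of le_rfl ENNReal.one_ne_top hF fun ε hε => ?_
    lift ε to NNReal using hε.le
    have hε0 : ε ≠ 0 := by exact_mod_cast hε.ne'
    refine ⟨(K + 1) / ε, fun n => ?_⟩
    have hC0 : (K + 1) / ε ≠ 0 := div_ne_zero (by positivity) hε0
    have hmain : (((K + 1) / ε : NNReal) : ENNReal) *
        eLpNorm ({x | (K + 1) / ε ≤ ‖F n x‖₊}.indicator (F n)) 1 μ ≤ K := by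
      rw [eLpNorm_one_eq_lintegral_enorm, ← lintegral_const_mul' _ _ ENNReal.coe_ne_top]
      refine le_trans (lintegral_mono fun x => ?_) (hK n)
      by_cases hx : (K + 1) / ε ≤ ‖F n x‖₊
      · rw [Set.indicator_of_mem (by exact hx), sq]
        gcongr
        exact ENNReal.coe_le_coe.2 hx
      · rw [Set.indicator_of_notMem (by exact hx)]
        simp
    have hle := (ENNReal.le_div_iff_mul_le (Or.inl (ENNReal.coe_ne_zero.2 hC0))
      (Or.inl ENNReal.coe_ne_top)).2 ((mul_comm _ _).trans_le hmain)
    refine hle.trans ?_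
    rw [ENNReal.ofReal_coe_nnreal, ← ENNReal.coe_div hC0, ENNReal.coe_le_coe,
      div_le_iff₀ (by positivity), mul_div_cancel₀ _ hε0]
    exact le_self_add
  have hmem : MemLp h 1 μ := hui.memLp_of_ae_tendsto hlim
  exact tendsto_integral_of_L1' h hmem.1
    (Eventually.of_forall fun n => memLp_one_iff_integrable.1 (hui.memLp n))
    (tendsto_Lp_finite_of_tendsto_ae le_rfl ENNReal.one_ne_top hF hmem hui.unifIntegrable hlim)

lemma integral_mul_uc_mul_inv_eq_zero {F : ℂ → ℂ} (hF : DifferentiableOn ℂ F unitDisk) {r : ℝ}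
    (hr : r ∈ Set.Ico (0 : ℝ) 1) {w : ℂ} (hw : ‖w‖ < 1) :
    (∫ θ in (0:ℝ)..(2 * Real.pi), F (r * uc θ) * (uc θ * (1 - w * uc θ)⁻¹)) = 0 := by
  have hne : ∀ z ∈ Metric.closedBall (0 : ℂ) 1, 1 - w * z ≠ 0 := fun z hz h0 => by
    have h1 : ‖w * z‖ = 1 := by rw [← sub_eq_zero.1 h0, norm_one]
    rw [norm_mul] at h1
    have hz' : ‖z‖ ≤ 1 := by simpa using hz
    nlinarith [norm_nonneg w, norm_nonneg z]
  have hd : DifferentiableOn ℂ (fun z => F (r * z) * (1 - w * z)⁻¹) (Metric.closedBall 0 1) := by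
    refine DifferentiableOn.mul (hF.comp (by fun_prop) fun z hz => ?_)
      (DifferentiableOn.inv (by fun_prop) hne)
    have hz' : ‖z‖ ≤ 1 := by simpa using hz
    rw [mem_unitDisk, norm_mul, Complex.norm_of_nonneg hr.1]
    nlinarith [hr.1, hr.2]
  have h0 := (hd.mono (by rw [closure_ball _ one_ne_zero])).diffContOnCl.circleIntegral_eq_zero
    zero_le_one
  rw [circleIntegral_eq_uc, mul_eq_zero, or_iff_right I_ne_zero] at h0
  rw [← h0]
  refine intervalIntegral.integral_congr fun θ _ => ?_
  simp only [ofReal_one, one_mul]; ring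

lemma MemH2.integral_bdry_mul_eq_zero {g : ℂ → ℂ} (hg : MemH2 g) {w : ℂ} (hw : ‖w‖ < 1) :
    (∫ θ in (0:ℝ)..(2 * Real.pi), bdry g θ * (uc θ * (1 - w * uc θ)⁻¹)) = 0 := by
  obtain ⟨C, hC⟩ := hg.2
  have hr : ∀ n : ℕ, 1 - 1 / ((n : ℝ) + 1) ∈ Set.Ico (0 : ℝ) 1 := fun n => by
    have h1 : 1 / ((n : ℝ) + 1) ≤ 1 := by
      rw [div_le_one (by positivity)]; linarith [n.cast_nonneg (α := ℝ)]
    have h2 : 0 < 1 / ((n : ℝ) + 1) := by positivity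
    constructor <;> linarith
  have hrlim : Tendsto (fun n : ℕ => 1 - 1 / ((n : ℝ) + 1)) atTop (nhdsWithin 1 (Set.Iio 1)) := by
    refine tendsto_nhdsWithin_iff.2 ⟨?_, Eventually.of_forall fun n => (hr n).2⟩
    simpa using tendsto_one_div_add_atTop_nhds_zero_nat.const_sub (1 : ℝ)
  have hne : ∀ θ, 1 - w * uc θ ≠ 0 := fun θ h0 => by
    have h1 : ‖w * uc θ‖ = 1 := by rw [← sub_eq_zero.1 h0, norm_one]
    rw [norm_mul, norm_uc, mul_one] at h1
    exact hw.ne h1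
  have huc := continuous_uc
  have hv : Continuous fun θ => uc θ * (1 - w * uc θ)⁻¹ :=
    huc.mul (Continuous.inv₀ (by fun_prop) hne)
  have hvle : ∀ θ, ‖uc θ * (1 - w * uc θ)⁻¹‖ ≤ (1 - ‖w‖)⁻¹ := fun θ => by
    rw [norm_mul, norm_uc, one_mul, norm_inv]
    refine inv_anti₀ (by linarith) ?_
    have := norm_sub_norm_le 1 (w * uc θ)
    rwa [norm_mul, norm_uc, mul_one, norm_one] at this
  have hc : ∀ n : ℕ, Continuous fun θ => g (((1 - 1 / ((n : ℝ) + 1) : ℝ) : ℂ) * uc θ) *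
      (uc θ * (1 - w * uc θ)⁻¹) := fun n => (hg.1.continuous_circle (hr n)).mul hv
  have hlim := tendsto_integral_of_lintegral_sq_le (μ := bMeasure)
    (h := fun θ => bdry g θ * (uc θ * (1 - w * uc θ)⁻¹))
    (K := (C * (1 - ‖w‖)⁻¹ ^ 2).toNNReal)
    (fun n => (hc n).aestronglyMeasurable) (fun n => by
      have hc2 : Continuous fun θ => ‖g (((1 - 1 / ((n : ℝ) + 1) : ℝ) : ℂ) * uc θ)‖ ^ 2 :=
        (hg.1.continuous_circle (hr n)).norm.pow 2
      calc _ ≤ ∫⁻ θ, ENNReal.ofReal (‖g (((1 - 1 / ((n : ℝ) + 1) : ℝ) : ℂ) * uc θ)‖ ^ 2 *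
              (1 - ‖w‖)⁻¹ ^ 2) ∂bMeasure := by
            refine lintegral_mono fun θ => ?_
            rw [← ofReal_norm, ← ENNReal.ofReal_pow (norm_nonneg _), norm_mul, mul_pow]
            refine ENNReal.ofReal_le_ofReal ?_
            gcongr
            exact hvle θ
        _ = ENNReal.ofReal (∫ θ, ‖g (((1 - 1 / ((n : ℝ) + 1) : ℝ) : ℂ) * uc θ)‖ ^ 2 *
              (1 - ‖w‖)⁻¹ ^ 2 ∂bMeasure) := by
            refine (ofReal_integral_eq_lintegral_ofReal ?_
              (Eventually.of_forall fun θ => by positivity)).symm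
            exact ((hc2.mul continuous_const).intervalIntegrable 0 (2 * Real.pi)).1
        _ ≤ _ := by
            refine ENNReal.ofReal_le_ofReal ?_
            rw [integral_mul_const]
            gcongr
            refine le_trans (le_of_eq ?_) (hC _ (hr n))
            rw [intervalIntegral.integral_of_le Real.two_pi_pos.le, bMeasure])
    (by
      filter_upwards [hg.ae_tendsto_bdry] with θ hθ
      exact (hθ.comp hrlim).mul_const _)
  rw [intervalIntegral.integral_of_le Real.two_pi_pos.le]
  refine tendsto_nhds_unique hlim (tendsto_const_nhds.congr fun n => ?_)
  rw [bMeasure, ← intervalIntegral.integral_of_le Real.two_pi_pos.le,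
    integral_mul_uc_mul_inv_eq_zero hg.1 (hr n) hw]

lemma IsInner.memH2 {I : ℂ → ℂ} (hI : IsInner I) : MemH2 I := by
  refine ⟨hI.1, 2 * Real.pi, fun r hr => ?_⟩
  have hc : Continuous fun θ => ‖I (r * uc θ)‖ ^ 2 := (hI.1.continuous_circle hr).norm.pow 2
  calc (∫ θ in (0:ℝ)..(2 * Real.pi), ‖I ((r : ℂ) * uc θ)‖ ^ 2)
      ≤ ∫ _ in (0:ℝ)..(2 * Real.pi), (1 : ℝ) :=
        intervalIntegral.integral_mono_on Real.two_pi_pos.le (hc.intervalIntegrable _ _)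
          intervalIntegrable_const fun θ _ =>
            pow_le_one₀ (norm_nonneg _) (hI.2.1 _ (ofReal_mul_uc_mem hr θ))
    _ = 2 * Real.pi := by simp

lemma ae_one_add_uc_ne_zero : ∀ᵐ θ ∂bMeasure, 1 + uc θ ≠ 0 := by
  have hpi : ∀ᵐ θ ∂bMeasure, θ ≠ Real.pi :=
    ae_restrict_of_ae (Measure.ae_ne volume Real.pi)
  have hmem : ∀ᵐ θ ∂bMeasure, θ ∈ Set.Ioc 0 (2 * Real.pi) := ae_restrict_mem measurableSet_Ioc
  filter_upwards [hpi, hmem] with θ hθ hm h0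
  have h1 : Complex.exp (((θ - Real.pi : ℝ) : ℂ) * I) = 1 := by
    push_cast
    rw [sub_mul, Complex.exp_sub, Complex.exp_pi_mul_I, show Complex.exp (θ * I) = -1 from
      (neg_eq_of_add_eq_zero_right h0).symm]
    norm_num
  obtain ⟨n, hn⟩ := Complex.exp_eq_one_iff.1 h1
  have h2 : θ - Real.pi = n * (2 * Real.pi) := by
    have := congrArg Complex.im hn
    simpa using this
  have hp := Real.pi_pos
  have hn0 : n = 0 := by
    have h3 : (n : ℝ) < 1 := by by_contra! h; nlinarith [hm.2]
    have h4 : (-1 : ℝ) < n := by by_contra! h; nlinarith [hm.1]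
    have h3' : n < 1 := by exact_mod_cast h3
    have h4' : -1 < n := by exact_mod_cast h4
    omega
  rw [hn0] at h2
  exact hθ (by simpa [sub_eq_zero] using h2)

lemma symbIf_mul_bdry_ae_eq {I f : ℂ → ℂ} (hI : IsInner I) (hf : MemH2 f)
    (hg : MemH2 fun w => f w * (I w + 1) / (1 + w)) :
    ∀ᵐ θ ∂bMeasure, symbIf I f θ * bdry (fun w => f w * (I w + 1) / (1 + w)) θ =
      (uc θ)⁻¹ * (starRingEnd ℂ) (bdry (fun w => f w * (I w + 1) / (1 + w)) θ) := by
  filter_upwards [hI.memH2.ae_tendsto_bdry, hf.ae_tendsto_bdry, hg.ae_tendsto_bdry, hI.2.2,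
    ae_one_add_uc_ne_zero] with θ hIθ hfθ hgθ hnorm hne
  have hu : Tendsto (fun r : ℝ => 1 + (r : ℂ) * uc θ) (nhdsWithin 1 (Set.Iio 1))
      (nhds (1 + uc θ)) := by
    have : Continuous fun r : ℝ => 1 + (r : ℂ) * uc θ := by fun_prop
    simpa using (this.tendsto 1).mono_left nhdsWithin_le_nhds
  rw [tendsto_nhds_unique hgθ ((hfθ.mul (hIθ.add_const 1)).div hu hne), symbIf]
  have hII : bdry I θ * (starRingEnd ℂ) (bdry I θ) = 1 := by
    rw [Complex.mul_conj, Complex.normSq_eq_norm_sq, hnorm]; simp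
  have hu0 := uc_ne_zero θ
  have hne' : 1 + (uc θ)⁻¹ ≠ 0 := fun h0 => hne (by field_simp at h0; linear_combination h0)
  simp only [map_div₀, map_mul, map_add, map_one, conj_uc]
  by_cases hf0 : bdry f θ = 0
  · simp [hf0]
  have hne'' : uc θ + 1 ≠ 0 := by rwa [add_comm]
  field_simp
  linear_combination (starRingEnd ℂ) (bdry f θ) * (1 + uc θ) * hII

/-- Remark, first computation.  Let `I` be inner with `I(0) = 0`
and `f` outer in `H²`.  Then `g = f·k₋₁·(I+1)`, with `k₋₁(z) = (1+z)⁻¹`, lies in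
`ker T_{Ī f̄/f}`. -/
theorem spanning_function_in_kernel (I f : ℂ → ℂ)
    (hI : IsInner I) (hI0 : I 0 = 0)
    (hf : IsOuter f) (hf2 : MemH2 f)
    (hg : MemH2 (fun w => f w * (I w + 1) / (1 + w))) :
    ∀ z ∈ unitDisk,
      toeplitz (symbIf I f) (fun w => f w * (I w + 1) / (1 + w)) z = 0 := by
  intro z hz
  have hsym : ∀ᵐ θ, θ ∈ Set.uIoc 0 (2 * Real.pi) →
      symbIf I f θ * bdry (fun w => f w * (I w + 1) / (1 + w)) θ * (1 - z * (uc θ)⁻¹)⁻¹ =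
        (starRingEnd ℂ) (bdry (fun w => f w * (I w + 1) / (1 + w)) θ *
          (uc θ * (1 - (starRingEnd ℂ) z * uc θ)⁻¹)) := by
    have h := symbIf_mul_bdry_ae_eq hI hf2 hg
    rw [bMeasure, ae_restrict_iff' measurableSet_Ioc] at h
    rw [Set.uIoc_of_le Real.two_pi_pos.le]
    filter_upwards [h] with θ hθ hm
    rw [hθ hm]
    simp only [map_mul, map_inv₀, map_sub, map_one, conj_uc, Complex.conj_conj]
    ring
  have hw : ‖(starRingEnd ℂ) z‖ < 1 := by rw [RCLike.norm_conj]; exact mem_unitDisk.1 hz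
  have h0 := congrArg (starRingEnd ℂ) (hg.integral_bdry_mul_eq_zero hw)
  rw [map_zero, intervalIntegral.integral_of_le Real.two_pi_pos.le, ← integral_conj,
    ← intervalIntegral.integral_of_le Real.two_pi_pos.le] at h0
  simp only [toeplitz, szProj]
  rw [intervalIntegral.integral_congr_ae hsym, h0, mul_zero]

end
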